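/- Fix σ > 0 and a probability distribution q₀ on ℝ^D with finite second moment. Let p_t(y) = E_{y₀∼q₀}[N(y | y₀, σ²I)] be the Gaussian-smoothed density. For any measurable s : ℝ^D → ℝ^D with E_{p_t}‖s‖² < ∞, the denoising score matching objective E_{y₀∼q₀} E_{y∼N(y₀,σ²I)} ‖s(y) + (y − y₀)/σ²‖² equals E_{y∼p_t} ‖s(y) − ∇_y log p_t(y)‖² + C, where C = E_{y₀∼q₀} E_{y∼N(y₀,σ²I)} ‖(y−y₀)/σ² ‖² − E_{y∼p_t}‖∇ log p_t(y)‖² does not depend on s. -/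

import Mathlib

open MeasureTheory

noncomputable def gaussPdfE (D : ℕ) (y₀ : EuclideanSpace ℝ (Fin D)) (σ : ℝ)
    (y : EuclideanSpace ℝ (Fin D)) : ℝ :=
  (2 * Real.pi * σ ^ 2) ^ (-(D : ℝ) / 2) * Real.exp (-‖y - y₀‖ ^ 2 / (2 * σ ^ 2))

section ConditionalMean

variable {X Y E : Type*} [MeasurableSpace X] [MeasurableSpace Y]
  [NormedAddCommGroup E] [InnerProductSpace ℝ E] [CompleteSpace E]

/-- If `G` is minus the mean of `v` under the weight `g` of total mass `p`, its squared norm is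
bounded by the second moment of `v`. -/
theorem mul_sq_norm_le_integral_of_smul_eq_neg_integral {q : Measure X} {g : X → ℝ} {v : X → E}
    {p : ℝ} {G : E} (hg₀ : ∀ x, 0 ≤ g x) (hg : Integrable g q) (hp : p = ∫ x, g x ∂q)
    (hgv : Integrable (fun x => g x • v x) q) (hG : p • G = -∫ x, g x • v x ∂q)
    (hgv₂ : Integrable (fun x => g x * ‖v x‖ ^ 2) q) :
    p * ‖G‖ ^ 2 ≤ ∫ x, g x * ‖v x‖ ^ 2 ∂q := by
  have hinner : ∫ x, inner ℝ G (g x • v x) ∂q = -(p * ‖G‖ ^ 2) := by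
    rw [integral_inner hgv, ← neg_eq_iff_eq_neg.mpr hG, inner_neg_right, real_inner_smul_right,
      real_inner_self_eq_norm_sq]
  have hnonneg : 0 ≤ ∫ x, g x * ‖G + v x‖ ^ 2 ∂q :=
    integral_nonneg fun x => mul_nonneg (hg₀ x) (sq_nonneg _)
  have hexpand : ∀ x, g x * ‖G + v x‖ ^ 2 =
      g x * ‖G‖ ^ 2 + 2 * inner ℝ G (g x • v x) + g x * ‖v x‖ ^ 2 := fun x => by
    rw [norm_add_sq_real, real_inner_smul_right]; ring
  have hint : Integrable (fun x => inner ℝ G (g x • v x)) q := hgv.const_inner G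
  simp_rw [hexpand] at hnonneg
  rw [integral_add ((hg.mul_const _).fun_add (hint.const_mul 2)) hgv₂,
    integral_add (hg.mul_const _) (hint.const_mul 2), integral_mul_const, integral_const_mul,
    hinner, ← hp] at hnonneg
  linarith

variable [MeasurableSpace E] [BorelSpace E] [SecondCountableTopology E]

/-- Regression onto `-v` and regression onto its conditional mean `G` given `Y` differ by a
constant that does not depend on the regressor `s`. -/
theorem integral_sq_norm_add_eq_integral_sq_norm_sub_condMean
    {q : Measure X} {ν : Measure Y} [SFinite q] [SFinite ν]
    {g : X → Y → ℝ} {v : X → Y → E} {p : Y → ℝ} {G s : Y → E}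
    (hg₀ : ∀ x y, 0 ≤ g x y) (hgm : Measurable fun z : X × Y => g z.1 z.2)
    (hvm : Measurable fun z : X × Y => v z.1 z.2)
    (hg : ∀ y, Integrable (fun x => g x y) q) (hp : ∀ y, p y = ∫ x, g x y ∂q)
    (hgv : ∀ y, Integrable (fun x => g x y • v x y) q)
    (hgv₂ : Integrable (fun z : X × Y => g z.1 z.2 * ‖v z.1 z.2‖ ^ 2) (q.prod ν))
    (hGm : Measurable G) (hG : ∀ y, p y • G y = -∫ x, g x y • v x y ∂q)
    (hsm : Measurable s) (hs : Integrable (fun y => p y * ‖s y‖ ^ 2) ν) :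
    ∫ x, (∫ y, g x y * ‖s y + v x y‖ ^ 2 ∂ν) ∂q =
      (∫ y, p y * ‖s y - G y‖ ^ 2 ∂ν) +
        ((∫ x, (∫ y, g x y * ‖v x y‖ ^ 2 ∂ν) ∂q) - ∫ y, p y * ‖G y‖ ^ 2 ∂ν) := by
  have hp₀ : ∀ y, 0 ≤ p y := fun y => by
    rw [hp]; exact integral_nonneg fun x => hg₀ x y
  have hpm : Measurable p := by
    rw [funext hp]
    exact hgm.stronglyMeasurable.integral_prod_left'.measurable
  have hsm' : Measurable fun z : X × Y => s z.2 := hsm.comp measurable_snd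
  have hgs : Integrable (fun z : X × Y => g z.1 z.2 * ‖s z.2‖ ^ 2) (q.prod ν) := by
    rw [integrable_prod_iff' (hgm.fun_mul (hsm'.norm.pow_const 2)).aestronglyMeasurable]
    refine ⟨.of_forall fun y => (hg y).mul_const (‖s y‖ ^ 2), hs.congr (.of_forall fun y => ?_)⟩
    simp only [Real.norm_eq_abs, abs_mul, abs_of_nonneg (hg₀ _ _), abs_pow, abs_norm]
    rw [integral_mul_const, hp]
  have hgsv : Integrable (fun z : X × Y => inner ℝ (s z.2) (g z.1 z.2 • v z.1 z.2))
      (q.prod ν) := by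
    refine (hgs.add hgv₂).mono' (hsm'.inner (hgm.smul hvm)).aestronglyMeasurable
      (.of_forall fun z => ?_)
    rw [real_inner_smul_right, Real.norm_eq_abs, abs_mul, abs_of_nonneg (hg₀ _ _)]
    have h := abs_real_inner_le_norm (s z.2) (v z.1 z.2)
    simp only [Pi.add_apply, ← mul_add]
    refine mul_le_mul_of_nonneg_left ?_ (hg₀ _ _)
    nlinarith [sq_nonneg (‖s z.2‖ - ‖v z.1 z.2‖), sq_nonneg ‖s z.2‖, sq_nonneg ‖v z.1 z.2‖]
  have hpG : Integrable (fun y => p y * ‖G y‖ ^ 2) ν := by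
    refine hgv₂.integral_prod_right.mono' (hpm.mul (hGm.norm.pow_const 2)).aestronglyMeasurable ?_
    filter_upwards [hgv₂.prod_left_ae] with y hy
    rw [Real.norm_eq_abs, abs_of_nonneg (mul_nonneg (hp₀ y) (sq_nonneg _))]
    exact mul_sq_norm_le_integral_of_smul_eq_neg_integral (fun x => hg₀ x y) (hg y) (hp y)
      (hgv y) (hG y) hy
  have hslice : ∀ y, ∫ x, inner ℝ (s y) (g x y • v x y) ∂q = -(p y * inner ℝ (s y) (G y)) :=
    fun y => by
      rw [integral_inner (hgv y), ← neg_eq_iff_eq_neg.mpr (hG y), inner_neg_right,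
        real_inner_smul_right]
  have hpsG : Integrable (fun y => p y * inner ℝ (s y) (G y)) ν := by
    have h := hgsv.integral_prod_right.neg
    simpa only [hslice, Pi.neg_def, neg_neg] using h
  have hcross : ∫ z, inner ℝ (s z.2) (g z.1 z.2 • v z.1 z.2) ∂(q.prod ν) =
      -∫ y, p y * inner ℝ (s y) (G y) ∂ν := by
    rw [integral_prod_symm _ hgsv, ← integral_neg]
    exact integral_congr_ae (.of_forall hslice)
  have hsq : ∫ z, g z.1 z.2 * ‖s z.2‖ ^ 2 ∂(q.prod ν) = ∫ y, p y * ‖s y‖ ^ 2 ∂ν := by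
    rw [integral_prod_symm _ hgs]
    refine integral_congr_ae (.of_forall fun y => ?_)
    simp only [integral_mul_const, hp]
  have hexpand : ∀ z : X × Y, g z.1 z.2 * ‖s z.2 + v z.1 z.2‖ ^ 2 = g z.1 z.2 * ‖s z.2‖ ^ 2 +
      2 * inner ℝ (s z.2) (g z.1 z.2 • v z.1 z.2) + g z.1 z.2 * ‖v z.1 z.2‖ ^ 2 := fun z => by
    rw [norm_add_sq_real, real_inner_smul_right]; ring
  have hjoint : Integrable (fun z : X × Y => g z.1 z.2 * ‖s z.2 + v z.1 z.2‖ ^ 2)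
      (q.prod ν) := by
    simp_rw [hexpand]
    exact (hgs.add (hgsv.const_mul 2)).add hgv₂
  have hleft : ∫ x, (∫ y, g x y * ‖s y + v x y‖ ^ 2 ∂ν) ∂q =
      (∫ y, p y * ‖s y‖ ^ 2 ∂ν) - 2 * (∫ y, p y * inner ℝ (s y) (G y) ∂ν) +
        ∫ x, (∫ y, g x y * ‖v x y‖ ^ 2 ∂ν) ∂q := by
    rw [← integral_prod _ hjoint, ← integral_prod _ hgv₂]
    simp_rw [hexpand]
    rw [integral_add (hgs.fun_add (hgsv.const_mul 2)) hgv₂, integral_add hgs (hgsv.const_mul 2),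
      integral_const_mul, hcross, hsq]
    ring
  have hright : ∫ y, p y * ‖s y - G y‖ ^ 2 ∂ν =
      (∫ y, p y * ‖s y‖ ^ 2 ∂ν) - 2 * (∫ y, p y * inner ℝ (s y) (G y) ∂ν) +
        ∫ y, p y * ‖G y‖ ^ 2 ∂ν := by
    have h : ∀ y, p y * ‖s y - G y‖ ^ 2 =
        p y * ‖s y‖ ^ 2 + -2 * (p y * inner ℝ (s y) (G y)) + p y * ‖G y‖ ^ 2 := fun y => by
      rw [norm_sub_sq_real]; ring
    simp_rw [h]
    rw [integral_add (hs.fun_add (hpsG.const_mul _)) hpG, integral_add hs (hpsG.const_mul _),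
      integral_const_mul]
    ring
  rw [hleft, hright]
  ring

end ConditionalMean

section GaussianKernel

variable {D : ℕ} {σ : ℝ}

theorem gaussPdfE_pos (hσ : 0 < σ) (y₀ y : EuclideanSpace ℝ (Fin D)) :
    0 < gaussPdfE D y₀ σ y := by
  unfold gaussPdfE; positivity

theorem gaussPdfE_le (hσ : 0 < σ) (y₀ y : EuclideanSpace ℝ (Fin D)) :
    gaussPdfE D y₀ σ y ≤ (2 * Real.pi * σ ^ 2) ^ (-(D : ℝ) / 2) := by
  refine mul_le_of_le_one_right (by positivity) (Real.exp_le_one_iff.mpr ?_)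
  rw [neg_div, Left.neg_nonpos_iff]
  positivity

theorem continuous_gaussPdfE :
    Continuous fun z : EuclideanSpace ℝ (Fin D) × EuclideanSpace ℝ (Fin D) =>
      gaussPdfE D z.1 σ z.2 := by
  unfold gaussPdfE; fun_prop

theorem Real.mul_exp_neg_sq_div_le (hσ : 0 < σ) (t : ℝ) :
    t * Real.exp (-t ^ 2 / (2 * σ ^ 2)) ≤ σ := by
  have hexp := Real.add_one_le_exp (t ^ 2 / (2 * σ ^ 2))
  have ht : t ≤ σ * Real.exp (t ^ 2 / (2 * σ ^ 2)) := by
    refine le_trans ?_ (mul_le_mul_of_nonneg_left hexp hσ.le)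
    have h : σ * (t ^ 2 / (2 * σ ^ 2) + 1) - t = ((t - σ) ^ 2 + σ ^ 2) / (2 * σ) := by
      field_simp; ring
    have : 0 ≤ ((t - σ) ^ 2 + σ ^ 2) / (2 * σ) := by positivity
    linarith
  rwa [neg_div, Real.exp_neg, ← div_eq_mul_inv, div_le_iff₀ (Real.exp_pos _)]

theorem norm_gaussPdfE_smul_sub_le (hσ : 0 < σ) (y₀ y : EuclideanSpace ℝ (Fin D)) :
    ‖gaussPdfE D y₀ σ y • (σ ^ 2)⁻¹ • (y - y₀)‖ ≤
      (2 * Real.pi * σ ^ 2) ^ (-(D : ℝ) / 2) * (σ ^ 2)⁻¹ * σ := by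
  have h := Real.mul_exp_neg_sq_div_le hσ ‖y - y₀‖
  rw [norm_smul, norm_smul, Real.norm_of_nonneg (gaussPdfE_pos hσ _ _).le,
    Real.norm_of_nonneg (by positivity)]
  calc gaussPdfE D y₀ σ y * ((σ ^ 2)⁻¹ * ‖y - y₀‖)
      = (2 * Real.pi * σ ^ 2) ^ (-(D : ℝ) / 2) * (σ ^ 2)⁻¹ *
          (‖y - y₀‖ * Real.exp (-‖y - y₀‖ ^ 2 / (2 * σ ^ 2))) := by unfold gaussPdfE; ring
    _ ≤ _ := by gcongr

theorem hasGradientAt_gaussPdfE (y₀ y : EuclideanSpace ℝ (Fin D)) :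
    HasGradientAt (gaussPdfE D y₀ σ) (-(gaussPdfE D y₀ σ y • (σ ^ 2)⁻¹ • (y - y₀))) y := by
  rw [hasGradientAt_iff_hasFDerivAt]
  have h := (((((hasFDerivAt_id y).sub_const y₀).norm_sq).neg.mul_const
    (2 * σ ^ 2)⁻¹).exp).const_mul ((2 * Real.pi * σ ^ 2) ^ (-(D : ℝ) / 2))
  refine h.congr_fderiv ?_
  ext w
  simp [gaussPdfE, div_eq_mul_inv]
  ring

variable {q₀ : Measure (EuclideanSpace ℝ (Fin D))}

theorem integrable_gaussPdfE_left [IsFiniteMeasure q₀] (hσ : 0 < σ)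
    (y : EuclideanSpace ℝ (Fin D)) : Integrable (fun y₀ => gaussPdfE D y₀ σ y) q₀ := by
  refine Integrable.of_bound (C := (2 * Real.pi * σ ^ 2) ^ (-(D : ℝ) / 2))
    (continuous_gaussPdfE.comp (Continuous.prodMk_left y)).aestronglyMeasurable
    (.of_forall fun y₀ => ?_)
  rw [Real.norm_of_nonneg (gaussPdfE_pos hσ _ _).le]
  exact gaussPdfE_le hσ _ _

theorem integrable_gaussPdfE_smul_sub_left [IsFiniteMeasure q₀] (hσ : 0 < σ)
    (y : EuclideanSpace ℝ (Fin D)) :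
    Integrable (fun y₀ => gaussPdfE D y₀ σ y • (σ ^ 2)⁻¹ • (y - y₀)) q₀ := by
  refine Integrable.of_bound
    (((continuous_gaussPdfE.comp (Continuous.prodMk_left y)).smul
      (by fun_prop)).aestronglyMeasurable) _
    (.of_forall fun y₀ => norm_gaussPdfE_smul_sub_le hσ y₀ y)

theorem integral_gaussPdfE_pos [IsProbabilityMeasure q₀] (hσ : 0 < σ)
    (y : EuclideanSpace ℝ (Fin D)) : 0 < ∫ y₀, gaussPdfE D y₀ σ y ∂q₀ := by
  rw [integral_pos_iff_support_of_nonneg (fun y₀ => (gaussPdfE_pos hσ y₀ y).le)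
    (integrable_gaussPdfE_left hσ y)]
  have : (Function.support fun y₀ => gaussPdfE D y₀ σ y) = Set.univ :=
    Set.eq_univ_of_forall fun y₀ => (gaussPdfE_pos hσ y₀ y).ne'
  simp [this]

theorem hasGradientAt_integral_gaussPdfE [IsFiniteMeasure q₀] (hσ : 0 < σ)
    (y : EuclideanSpace ℝ (Fin D)) :
    HasGradientAt (fun y => ∫ y₀, gaussPdfE D y₀ σ y ∂q₀)
      (-∫ y₀, gaussPdfE D y₀ σ y • (σ ^ 2)⁻¹ • (y - y₀) ∂q₀) y := by
  rw [hasGradientAt_iff_hasFDerivAt]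
  have hint := (integrable_gaussPdfE_smul_sub_left (q₀ := q₀) hσ y).neg
  have h := hasFDerivAt_integral_of_dominated_of_fderiv_le (μ := q₀) (𝕜 := ℝ)
    (F := fun y y₀ => gaussPdfE D y₀ σ y)
    (F' := fun y y₀ => InnerProductSpace.toDual ℝ _ (-(gaussPdfE D y₀ σ y • (σ ^ 2)⁻¹ • (y - y₀))))
    (bound := fun _ => (2 * Real.pi * σ ^ 2) ^ (-(D : ℝ) / 2) * (σ ^ 2)⁻¹ * σ)
    (x₀ := y) Filter.univ_mem
    (.of_forall fun y => (integrable_gaussPdfE_left hσ y).aestronglyMeasurable)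
    (integrable_gaussPdfE_left hσ y)
    ((InnerProductSpace.toDual ℝ (EuclideanSpace ℝ (Fin D))).continuous.comp_aestronglyMeasurable
      hint.aestronglyMeasurable)
    (.of_forall fun y₀ y _ => by
      rw [LinearIsometryEquiv.norm_map, norm_neg]
      exact norm_gaussPdfE_smul_sub_le hσ y₀ y)
    (integrable_const _)
    (.of_forall fun y₀ y _ => (hasGradientAt_gaussPdfE y₀ y).hasFDerivAt)
  refine h.congr_fderiv ?_
  rw [← integral_neg]
  exact (InnerProductSpace.toDual ℝ
    (EuclideanSpace ℝ (Fin D))).toContinuousLinearEquiv.toContinuousLinearMap.integral_comp_comm hint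

/-- Tweedie's formula: the score of a Gaussian mixture, multiplied by its density. -/
theorem smul_gradient_log_integral_gaussPdfE [IsProbabilityMeasure q₀] (hσ : 0 < σ)
    (y : EuclideanSpace ℝ (Fin D)) :
    (∫ y₀, gaussPdfE D y₀ σ y ∂q₀) •
        gradient (fun y => Real.log (∫ y₀, gaussPdfE D y₀ σ y ∂q₀)) y =
      -∫ y₀, gaussPdfE D y₀ σ y • (σ ^ 2)⁻¹ • (y - y₀) ∂q₀ := by
  have hpos := (integral_gaussPdfE_pos (q₀ := q₀) hσ y).ne'
  have h := (hasGradientAt_integral_gaussPdfE (q₀ := q₀) hσ y).hasFDerivAt.log hpos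
  rw [h.hasGradientAt.gradient, map_smulₛₗ, LinearIsometryEquiv.symm_apply_apply]
  simp [smul_smul, hpos]

theorem integrable_exp_neg_mul_sq_norm {b : ℝ} (hb : 0 < b) :
    Integrable fun z : EuclideanSpace ℝ (Fin D) => Real.exp (-b * ‖z‖ ^ 2) := by
  have h := (GaussianFourier.integrable_cexp_neg_mul_sq_norm_add (b := (b : ℂ))
    (by simpa using hb) 0 (0 : EuclideanSpace ℝ (Fin D))).norm
  refine h.congr (.of_forall fun z => ?_)
  simp [Complex.norm_exp, ← Complex.ofReal_pow]

theorem integrable_gaussPdfE_zero_mul_sq_norm (hσ : 0 < σ) :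
    Integrable fun z : EuclideanSpace ℝ (Fin D) =>
      gaussPdfE D 0 σ z * ‖(σ ^ 2)⁻¹ • z‖ ^ 2 := by
  have hb : 0 < (4 * σ ^ 2)⁻¹ := by positivity
  refine ((integrable_exp_neg_mul_sq_norm (D := D) hb).const_mul
    ((2 * Real.pi * σ ^ 2) ^ (-(D : ℝ) / 2) * (4 * (σ ^ 2)⁻¹))).mono'
    (by unfold gaussPdfE; exact Continuous.aestronglyMeasurable (by fun_prop))
    (.of_forall fun z => ?_)
  rw [Real.norm_of_nonneg (mul_nonneg (gaussPdfE_pos hσ _ _).le (sq_nonneg _)), gaussPdfE,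
    sub_zero, norm_smul, Real.norm_of_nonneg (by positivity)]
  set u := (4 * σ ^ 2)⁻¹ * ‖z‖ ^ 2 with hu
  have hexp : -‖z‖ ^ 2 / (2 * σ ^ 2) = -u + -u := by rw [hu]; field_simp; ring
  have hnorm : ((σ ^ 2)⁻¹ * ‖z‖) ^ 2 = 4 * (σ ^ 2)⁻¹ * u := by rw [hu]; field_simp
  have hle : u * Real.exp (-u) ≤ 1 := by
    rw [Real.exp_neg, ← div_eq_mul_inv, div_le_one (Real.exp_pos _)]
    linarith [Real.add_one_le_exp u]
  rw [hexp, hnorm, Real.exp_add, show -(4 * σ ^ 2)⁻¹ * ‖z‖ ^ 2 = -u by rw [hu]; ring]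
  calc (2 * Real.pi * σ ^ 2) ^ (-(D : ℝ) / 2) * (Real.exp (-u) * Real.exp (-u)) *
        (4 * (σ ^ 2)⁻¹ * u)
      = (2 * Real.pi * σ ^ 2) ^ (-(D : ℝ) / 2) * (4 * (σ ^ 2)⁻¹) * Real.exp (-u) *
          (u * Real.exp (-u)) := by ring
    _ ≤ _ := mul_le_of_le_one_right (by positivity) hle

theorem integrable_prod_gaussPdfE_mul_sq_norm [IsFiniteMeasure q₀] (hσ : 0 < σ) :
    Integrable (fun z : EuclideanSpace ℝ (Fin D) × EuclideanSpace ℝ (Fin D) =>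
      gaussPdfE D z.1 σ z.2 * ‖(σ ^ 2)⁻¹ • (z.2 - z.1)‖ ^ 2) (q₀.prod volume) := by
  have hshift : (fun z : EuclideanSpace ℝ (Fin D) × EuclideanSpace ℝ (Fin D) =>
      gaussPdfE D z.1 σ z.2 * ‖(σ ^ 2)⁻¹ • (z.2 - z.1)‖ ^ 2) =
      fun z => gaussPdfE D 0 σ (z.2 - z.1) * ‖(σ ^ 2)⁻¹ • (z.2 - z.1)‖ ^ 2 := by
    simp only [gaussPdfE, sub_zero]
  have hint := integrable_gaussPdfE_zero_mul_sq_norm (D := D) hσ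
  have hcont : Continuous fun z : EuclideanSpace ℝ (Fin D) × EuclideanSpace ℝ (Fin D) =>
      gaussPdfE D z.1 σ z.2 * ‖(σ ^ 2)⁻¹ • (z.2 - z.1)‖ ^ 2 :=
    continuous_gaussPdfE.mul (by fun_prop)
  rw [hshift] at hcont ⊢
  rw [integrable_prod_iff hcont.aestronglyMeasurable]
  refine ⟨.of_forall fun y₀ => hint.comp_sub_right y₀, ?_⟩
  have hconst : ∀ y₀ : EuclideanSpace ℝ (Fin D),
      ∫ y, ‖gaussPdfE D 0 σ (y - y₀) * ‖(σ ^ 2)⁻¹ • (y - y₀)‖ ^ 2‖ =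
        ∫ y, ‖gaussPdfE D 0 σ y * ‖(σ ^ 2)⁻¹ • y‖ ^ 2‖ := fun y₀ =>
    integral_sub_right_eq_self
      (fun y : EuclideanSpace ℝ (Fin D) => ‖gaussPdfE D 0 σ y * ‖(σ ^ 2)⁻¹ • y‖ ^ 2‖) y₀
  simp only [hconst]
  exact integrable_const _

end GaussianKernel

theorem stmt12 (D : ℕ) (σ : ℝ) (hσ : 0 < σ)
    (q₀ : Measure (EuclideanSpace ℝ (Fin D))) [IsProbabilityMeasure q₀]
    (hmom : Integrable (fun y₀ => ‖y₀‖ ^ 2) q₀)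
    (s : EuclideanSpace ℝ (Fin D) → EuclideanSpace ℝ (Fin D)) (hs : Measurable s)
    (pt : EuclideanSpace ℝ (Fin D) → ℝ)
    (hpt : ∀ y, pt y = ∫ y₀, gaussPdfE D y₀ σ y ∂q₀)
    (hsint : Integrable (fun y => pt y * ‖s y‖ ^ 2)) :
    ∫ y₀, (∫ y, gaussPdfE D y₀ σ y * ‖s y + (σ ^ 2)⁻¹ • (y - y₀)‖ ^ 2) ∂q₀ =
      (∫ y, pt y * ‖s y - gradient (fun y => Real.log (pt y)) y‖ ^ 2) +
        ((∫ y₀, (∫ y, gaussPdfE D y₀ σ y * ‖(σ ^ 2)⁻¹ • (y - y₀)‖ ^ 2) ∂q₀) -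
          ∫ y, pt y * ‖gradient (fun y => Real.log (pt y)) y‖ ^ 2) := by
  have hscore : ∀ y, pt y • gradient (fun y => Real.log (pt y)) y =
      -∫ y₀, gaussPdfE D y₀ σ y • (σ ^ 2)⁻¹ • (y - y₀) ∂q₀ := fun y => by
    rw [funext hpt]
    exact smul_gradient_log_integral_gaussPdfE hσ y
  have hgradm : Measurable (gradient fun y => Real.log (pt y)) :=
    (InnerProductSpace.toDual ℝ (EuclideanSpace ℝ (Fin D))).symm.continuous.measurable.comp
      (measurable_fderiv ℝ _)
  exact integral_sq_norm_add_eq_integral_sq_norm_sub_condMean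
    (v := fun y₀ y => (σ ^ 2)⁻¹ • (y - y₀)) (fun y₀ y => (gaussPdfE_pos hσ y₀ y).le)
    continuous_gaussPdfE.measurable (by fun_prop) (integrable_gaussPdfE_left hσ) hpt
    (integrable_gaussPdfE_smul_sub_left hσ) (integrable_prod_gaussPdfE_mul_sq_norm hσ) hgradm
    hscore hs hsint
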